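/- arXiv:1008.4887 — 5 statements merged into one kernel-verified Lean document; each statement's English description precedes it below -/
import Mathlib

section
/- Let v : ℕ → ℝ be a bgd-function with constant L ≥ 1. Then there exists a nondecreasing integer-valued function w : ℕ → ℕ having the same growth type as v such that: (i) w(0) = 1; (ii) for all n ∈ ℕ, 2 ≤ w(n+2) − w(n+1) ≤ 2·(w(n+1) − w(n)); (iii) there exist a real λ < 2 and a constant C > 0 with w(n) ≤ C·λ^n for all n. Moreover, if v(n+1) − v(n) tends to +∞ as n → ∞, then w(n+1) − w(n) also tends to +∞. -/
/-- Two nondecreasing nonnegative functions `v w : ℕ → ℝ` have the same growth type if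
there is a positive integer `A` with `w n ≤ A * v (A*n+A) + A` and `v n ≤ A * w (A*n+A) + A`
for all `n`. -/
def SameGrowthType (v w : ℕ → ℝ) : Prop :=
  ∃ A : ℕ, 0 < A ∧ ∀ n : ℕ,
    w n ≤ A * v (A * n + A) + A ∧ v n ≤ A * w (A * n + A) + A

/-- The largest sequence below `G` that starts at `G 0` and grows by a factor of at most `3 / 2`
at each step. -/
def growthTruncation (G : ℕ → ℕ) : ℕ → ℕ
  | 0 => G 0
  | n + 1 => min (G (n + 1)) (growthTruncation G n + growthTruncation G n / 2)

theorem growthTruncation_succ (G : ℕ → ℕ) (n : ℕ) :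
    growthTruncation G (n + 1) =
      min (G (n + 1)) (growthTruncation G n + growthTruncation G n / 2) := rfl

theorem growthTruncation_le (G : ℕ → ℕ) (n : ℕ) : growthTruncation G n ≤ G n := by
  cases n with
  | zero => exact le_rfl
  | succ n => exact min_le_left _ _

theorem two_le_growthTruncation {G : ℕ → ℕ} (hG : ∀ n, 2 ≤ G n) (n : ℕ) :
    2 ≤ growthTruncation G n := by
  induction n with
  | zero => exact hG 0
  | succ n ih => exact le_min (hG _) (by omega)

theorem growthTruncation_succ_le (G : ℕ → ℕ) (n : ℕ) :
    growthTruncation G (n + 1) ≤ growthTruncation G n + growthTruncation G n / 2 :=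
  min_le_right _ _

theorem growthTruncation_le_geometric (G : ℕ → ℕ) (n : ℕ) :
    (growthTruncation G n : ℝ) ≤ G 0 * (3 / 2) ^ n := by
  induction n with
  | zero => simp [growthTruncation]
  | succ n ih =>
    have h : 2 * growthTruncation G (n + 1) ≤ 3 * growthTruncation G n := by
      have := growthTruncation_succ_le G n
      omega
    have h' : 2 * (growthTruncation G (n + 1) : ℝ) ≤ 3 * growthTruncation G n := by
      exact_mod_cast h
    rw [pow_succ]
    linarith

/-- Unless it is capped by `G`, the truncation grows by a factor of at least `4 / 3`. -/
theorem min_le_growthTruncation_succ {G : ℕ → ℕ} (hG : ∀ n, 2 ≤ G n) (n : ℕ) :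
    min (G (n + 1) : ℝ) (4 / 3 * growthTruncation G n) ≤ growthTruncation G (n + 1) := by
  have h2 := two_le_growthTruncation hG n
  rw [growthTruncation_succ, Nat.cast_min]
  refine min_le_min le_rfl ?_
  have h : 4 * growthTruncation G n ≤ 3 * (growthTruncation G n + growthTruncation G n / 2) := by
    omega
  have h' : 4 * (growthTruncation G n : ℝ) ≤
      3 * ((growthTruncation G n + growthTruncation G n / 2 : ℕ) : ℝ) := by
    exact_mod_cast h
  linarith

/-- If `d` grows by a factor of at most `L` at each step, then truncating a majorant of the
stretched sequence `n ↦ d (n / (m + 1))` loses at most a factor `L`, for `m` large. -/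
theorem le_mul_growthTruncation {L : ℝ} (hL : 1 ≤ L) {d : ℕ → ℝ} (hd : ∀ n, 0 ≤ d n)
    (hdL : ∀ n, d (n + 1) ≤ L * d n) {m : ℕ} (hm : L ≤ (4 / 3) ^ m) {G : ℕ → ℕ}
    (hG : ∀ n, 2 ≤ G n) (hdG : ∀ n, d (n / (m + 1)) ≤ G n) (n : ℕ) :
    d (n / (m + 1)) ≤ L * growthTruncation G n := by
  have hL0 : 0 < L := by linarith
  have hdG' (q r : ℕ) (hr : r ≤ m) : d q ≤ G (q * (m + 1) + r) := by
    have h := hdG (q * (m + 1) + r)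
    rwa [mul_comm q, Nat.mul_add_div (Nat.succ_pos m), Nat.div_eq_of_lt (by omega), add_zero,
      mul_comm] at h
  have block (q : ℕ) (hq : d q ≤ L * growthTruncation G (q * (m + 1))) (r : ℕ) (hr : r ≤ m) :
      min (L * d q) (d q * (4 / 3) ^ r) ≤ L * growthTruncation G (q * (m + 1) + r) := by
    induction r with
    | zero => exact (min_le_right _ _).trans (by simpa using hq)
    | succ r ih =>
      have ih := ih (by omega)
      have hstep := min_le_growthTruncation_succ hG (q * (m + 1) + r)
      have hcap := hdG' q (r + 1) hr
      rw [← add_assoc] at hcap ⊢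
      have hd0 : 0 ≤ L * d q := mul_nonneg hL0.le (hd q)
      rcases min_le_iff.1 hstep with h | h
      · exact (min_le_left _ _).trans (mul_le_mul_of_nonneg_left (hcap.trans h) hL0.le)
      · have h := mul_le_mul_of_nonneg_left h hL0.le
        rcases min_le_iff.1 ih with h' | h'
        · exact (min_le_left _ _).trans (by linarith)
        · exact (min_le_right _ _).trans (by rw [pow_succ]; linarith)
  have start (q : ℕ) : d q ≤ L * growthTruncation G (q * (m + 1)) := by
    induction q with
    | zero =>
      have h : d 0 ≤ growthTruncation G 0 := by simpa [growthTruncation] using hdG 0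
      rw [zero_mul]
      nlinarith [hd 0]
    | succ q ih =>
      have hlast := block q ih m le_rfl
      rw [min_eq_left (by rw [mul_comm]; exact mul_le_mul_of_nonneg_left hm (hd q))] at hlast
      have hstep := min_le_growthTruncation_succ hG (q * (m + 1) + m)
      have hcap := hdG' (q + 1) 0 (Nat.zero_le m)
      rw [show (q + 1) * (m + 1) = q * (m + 1) + m + 1 by ring] at hcap ⊢
      rcases min_le_iff.1 hstep with h | h
      · nlinarith [hd (q + 1)]
      · have h := mul_le_mul_of_nonneg_left h hL0.le
        linarith [hdL q, mul_nonneg hL0.le (hd q)]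
  have h := block (n / (m + 1)) (start _) (n % (m + 1)) (Nat.lt_succ_iff.1 (Nat.mod_lt _ m.succ_pos))
  rw [Nat.div_add_mod'] at h
  refine le_trans (le_min ?_ ?_) h
  · nlinarith [hd (n / (m + 1))]
  · exact le_mul_of_one_le_right (hd _) (one_le_pow₀ (by norm_num))

theorem stmt0 (L : ℝ) (hL : 1 ≤ L) (v : ℕ → ℝ)
    (hv_mono : Monotone v) (hv_nonneg : ∀ n, 0 ≤ v n)
    (hbgd : ∀ n : ℕ, 1 / L ≤ v (n + 2) - v (n + 1) ∧
      v (n + 2) - v (n + 1) ≤ L * (v (n + 1) - v n)) :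
    ∃ w : ℕ → ℕ, Monotone w ∧
      SameGrowthType v (fun n => (w n : ℝ)) ∧
      w 0 = 1 ∧
      (∀ n : ℕ, (2 : ℤ) ≤ (w (n + 2) : ℤ) - (w (n + 1) : ℤ) ∧
        (w (n + 2) : ℤ) - (w (n + 1) : ℤ) ≤ 2 * ((w (n + 1) : ℤ) - (w n : ℤ))) ∧
      (∃ lam C : ℝ, lam < 2 ∧ 0 < C ∧ ∀ n : ℕ, (w n : ℝ) ≤ C * lam ^ n) ∧
      (Filter.Tendsto (fun n => v (n + 1) - v n) Filter.atTop Filter.atTop →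
        Filter.Tendsto (fun n => (w (n + 1) : ℤ) - (w n : ℤ)) Filter.atTop Filter.atTop) := by
  have hL0 : 0 < L := by linarith
  obtain ⟨d, hd⟩ : ∃ d : ℕ → ℝ, ∀ n, d n = v (n + 1) - v n := ⟨_, fun _ => rfl⟩
  have hdL (n : ℕ) : d (n + 1) ≤ L * d n := by
    rw [hd, hd]
    exact (hbgd n).2
  have hd1 (n : ℕ) : 1 ≤ L ^ 2 * d n := by
    have h1 := (hbgd n).1.trans (hbgd n).2
    rw [← hd, div_le_iff₀ hL0] at h1
    linarith
  have hd0 (n : ℕ) : 0 ≤ d n := by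
    have := hd1 n
    by_contra! h
    nlinarith [sq_pos_of_pos hL0]
  obtain ⟨m, hm⟩ := pow_unbounded_of_one_lt L (show (1 : ℝ) < 4 / 3 by norm_num)
  obtain ⟨G, hGdef⟩ : ∃ G : ℕ → ℕ, ∀ n, G n = ⌈d (n / (m + 1))⌉₊ + 1 := ⟨_, fun _ => rfl⟩
  have hG (n : ℕ) : 2 ≤ G n := by
    have : 0 < ⌈d (n / (m + 1))⌉₊ := by
      refine Nat.ceil_pos.2 ((hd0 _).lt_of_ne fun h => ?_)
      have := hd1 (n / (m + 1))
      rw [← h] at this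
      linarith
    rw [hGdef]
    omega
  have hdG (n : ℕ) : d (n / (m + 1)) ≤ G n := by
    rw [hGdef]
    push_cast
    linarith [Nat.le_ceil (d (n / (m + 1)))]
  have hGd (n : ℕ) : (G n : ℝ) ≤ (1 + 2 * L ^ 2) * d (n / (m + 1)) := by
    rw [hGdef]
    push_cast
    linarith [Nat.ceil_lt_add_one (hd0 (n / (m + 1))), hd1 (n / (m + 1))]
  have hlow (n : ℕ) : d (n / (m + 1)) ≤ L * growthTruncation G n :=
    le_mul_growthTruncation hL hd0 hdL hm.le hG hdG n
  obtain ⟨w, hw⟩ : ∃ w : ℕ → ℕ, ∀ n, w n = 1 + ∑ i ∈ Finset.range n, growthTruncation G i :=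
    ⟨_, fun _ => rfl⟩
  have hw0 : w 0 = 1 := by simp [hw]
  have hws (n : ℕ) : w (n + 1) = w n + growthTruncation G n := by
    rw [hw, hw, Finset.sum_range_succ, add_assoc]
  have hw_mono : Monotone w := monotone_nat_of_le_succ fun n => by rw [hws]; omega
  have hdiv (q r : ℕ) (hr : r < m + 1) : (q * (m + 1) + r) / (m + 1) = q := by
    rw [mul_comm, Nat.mul_add_div (Nat.succ_pos m), Nat.div_eq_of_lt hr, add_zero]
  have hw_le (q : ℕ) :
      (w (q * (m + 1)) : ℝ) ≤ 1 + (1 + 2 * L ^ 2) * (m + 1) * (v q - v 0) := by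
    induction q with
    | zero => simp [hw0]
    | succ q ih =>
      have hr (r : ℕ) (hr : r ≤ m + 1) : (w (q * (m + 1) + r) : ℝ) ≤
          w (q * (m + 1)) + (1 + 2 * L ^ 2) * r * d q := by
        induction r with
        | zero => simp
        | succ r ihr =>
          have h1 := hGd (q * (m + 1) + r)
          have h2 : (growthTruncation G (q * (m + 1) + r) : ℝ) ≤ G (q * (m + 1) + r) := by
            exact_mod_cast growthTruncation_le G _
          rw [hdiv q r (by omega)] at h1
          rw [← add_assoc, hws]
          push_cast
          linarith [ihr (by omega)]
      have h := hr (m + 1) le_rfl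
      rw [hd] at h
      rw [add_mul, one_mul]
      push_cast at h
      linarith
  have hv_le (q : ℕ) : v q ≤ v 0 + L * w (q * (m + 1)) := by
    induction q with
    | zero => rw [zero_mul, hw0]; push_cast; linarith
    | succ q ih =>
      have h := hlow (q * (m + 1))
      have hq := hdiv q 0 (Nat.succ_pos m)
      rw [add_zero] at hq
      rw [hq, hd] at h
      have hle : (w (q * (m + 1) + 1) : ℝ) ≤ w ((q + 1) * (m + 1)) := by
        exact_mod_cast hw_mono (by rw [add_mul]; omega)
      rw [hws] at hle
      push_cast at hle
      linarith [mul_le_mul_of_nonneg_left hle hL0.le]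
  refine ⟨w, hw_mono, ?_, hw0, fun n => ?_, ⟨3 / 2, 2 * G 0, by norm_num, ?_, fun n => ?_⟩,
    fun ht => ?_⟩
  · obtain ⟨A, hA⟩ := exists_nat_ge ((1 + 2 * L ^ 2) * (m + 1) + L + v 0 + (m + 1))
    have hB : 0 ≤ (1 + 2 * L ^ 2) * (m + 1 : ℝ) := by positivity
    have hmA : m + 1 ≤ A := by
      have : ((m + 1 : ℕ) : ℝ) ≤ A := by push_cast; linarith [hv_nonneg 0]
      exact_mod_cast this
    have hm0 : (0 : ℝ) ≤ m := m.cast_nonneg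
    have hv0 := hv_nonneg 0
    refine ⟨A, by omega, fun n => ⟨?_, ?_⟩⟩
    · have hvn : v n ≤ v (A * n + A) := hv_mono (by nlinarith)
      have hwn : (w n : ℝ) ≤ w (n * (m + 1)) := by exact_mod_cast hw_mono (by nlinarith)
      calc (w n : ℝ) ≤ 1 + (1 + 2 * L ^ 2) * (m + 1) * (v n - v 0) := hwn.trans (hw_le n)
        _ ≤ 1 + (1 + 2 * L ^ 2) * (m + 1) * v (A * n + A) := by gcongr; linarith
        _ ≤ A + A * v (A * n + A) :=
          add_le_add (by linarith)
            (mul_le_mul_of_nonneg_right (by linarith) (hv_nonneg _))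
        _ = A * v (A * n + A) + A := add_comm _ _
    · have hwn : (w (n * (m + 1)) : ℝ) ≤ w (A * n + A) := by
        exact_mod_cast hw_mono (by nlinarith)
      calc v n ≤ v 0 + L * w (A * n + A) :=
          (hv_le n).trans (add_le_add le_rfl (mul_le_mul_of_nonneg_left hwn hL0.le))
        _ ≤ A + A * w (A * n + A) :=
          add_le_add (by linarith) (mul_le_mul_of_nonneg_right (by linarith) (Nat.cast_nonneg _))
        _ = A * w (A * n + A) + A := add_comm _ _
  · have h1 := two_le_growthTruncation hG (n + 1)
    have h2 := growthTruncation_succ_le G n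
    rw [hws (n + 1), hws n]
    omega
  · have := hG 0
    have : 0 < G 0 := by omega
    positivity
  · induction n with
    | zero =>
      have : (2 : ℝ) ≤ G 0 := by exact_mod_cast hG 0
      rw [hw0]
      push_cast
      linarith
    | succ n ih =>
      rw [hws, pow_succ]
      push_cast
      linarith [growthTruncation_le_geometric G n]
  · have h1 : Filter.Tendsto (fun n => d (n / (m + 1))) Filter.atTop Filter.atTop :=
      (ht.congr fun n => (hd n).symm).comp (Nat.tendsto_div_const_atTop (Nat.succ_ne_zero m))
    have h2 := Filter.Tendsto.atTop_of_const_mul₀ hL0 (Filter.tendsto_atTop_mono hlow h1)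
    have h3 : Filter.Tendsto (growthTruncation G) Filter.atTop Filter.atTop :=
      tendsto_natCast_atTop_iff.1 h2
    refine (tendsto_natCast_atTop_atTop.comp h3).congr fun n => ?_
    rw [hws]
    simp
end

section
/- Let L ≥ 1 be a real number and let v : ℕ → ℕ be a nondecreasing function satisfying v(n+2) − v(n+1) ≤ L·(v(n+1) − v(n)) for all n ∈ ℕ, and such that v(n)/n → +∞ as n → ∞. Then there exists a function w : ℕ → ℝ having the same growth type as v such that: (i) for all n ∈ ℕ, 1/L ≤ w(n+2) − w(n+1) ≤ L·(w(n+1) − w(n)); and (ii) w(n+1) − w(n) → +∞ as n → ∞. -/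
/-- The increments `d`, raised towards the target `m` as fast as growth by a factor `L` per step
allows. -/
noncomputable def raisedIncrements (L : ℝ) (d m : ℕ → ℝ) : ℕ → ℝ
  | 0 => d 0
  | n + 1 => max (d (n + 1)) (min (L * raisedIncrements L d m n) (m (n + 1)))

section RaisedIncrements

variable {L : ℝ} {d m : ℕ → ℝ}

lemma le_raisedIncrements (n : ℕ) : d n ≤ raisedIncrements L d m n := by
  cases n with
  | zero => exact le_rfl
  | succ n => exact le_max_left _ _

lemma raisedIncrements_le_add (hd : ∀ n, 0 ≤ d n) (hm : ∀ n, 0 ≤ m n) (n : ℕ) :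
    raisedIncrements L d m n ≤ d n + m n := by
  cases n with
  | zero => exact le_add_of_nonneg_right (hm 0)
  | succ n =>
    exact max_le (le_add_of_nonneg_right (hm _))
      ((min_le_right _ _).trans (le_add_of_nonneg_left (hd _)))

lemma raisedIncrements_succ_le (hL : 0 ≤ L) (hd : ∀ n, d (n + 1) ≤ L * d n) (n : ℕ) :
    raisedIncrements L d m (n + 1) ≤ L * raisedIncrements L d m n :=
  max_le ((hd n).trans (mul_le_mul_of_nonneg_left (le_raisedIncrements n) hL)) (min_le_left _ _)

lemma tendsto_raisedIncrements (hL : 1 < L) (hd : ∀ n, 1 ≤ d n)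
    (hm : Filter.Tendsto m Filter.atTop Filter.atTop) :
    Filter.Tendsto (raisedIncrements L d m) Filter.atTop Filter.atTop := by
  refine Filter.tendsto_atTop.2 fun M => ?_
  obtain ⟨N, hN⟩ := Filter.eventually_atTop.1 (Filter.tendsto_atTop.1 hm (max M 0))
  have key : ∀ j, min (L ^ j) (max M 0) ≤ raisedIncrements L d m (N + j) := by
    intro j
    induction j with
    | zero =>
      rw [pow_zero]
      exact (min_le_left _ _).trans ((hd _).trans (le_raisedIncrements _))
    | succ j ih =>
      refine le_trans (le_min ?_ ?_) (le_max_right _ _)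
      · refine le_trans ?_ (mul_le_mul_of_nonneg_left ih (by linarith))
        rw [mul_min_of_nonneg _ _ (by linarith), ← pow_succ']
        exact min_le_min_left _ (le_mul_of_one_le_left (le_max_right _ _) hL.le)
      · exact (min_le_right _ _).trans (hN (N + j + 1) (by omega))
  obtain ⟨K, hK⟩ := pow_unbounded_of_one_lt M hL
  refine Filter.eventually_atTop.2 ⟨N + K, fun n hn => ?_⟩
  obtain ⟨j, rfl⟩ := Nat.exists_eq_add_of_le hn
  rw [add_assoc]
  refine le_trans (le_min ?_ (le_max_left _ _)) (key (K + j))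
  exact hK.le.trans (pow_le_pow_right₀ hL.le (by omega))

end RaisedIncrements

/-- The infimum of the slopes `v k / k` over `k ≥ n`. -/
noncomputable def slopeInf (v : ℕ → ℕ) (n : ℕ) : ℝ := ⨅ k : ℕ, (v (n + k) : ℝ) / (n + k : ℕ)

lemma slopeInf_nonneg (v : ℕ → ℕ) (n : ℕ) : 0 ≤ slopeInf v n :=
  Real.iInf_nonneg fun _ => by positivity

lemma slopeInf_le (v : ℕ → ℕ) {k n : ℕ} (h : k ≤ n) : slopeInf v k ≤ (v n : ℝ) / n := by
  obtain ⟨j, rfl⟩ := Nat.exists_eq_add_of_le h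
  refine ciInf_le ⟨0, ?_⟩ j
  rintro _ ⟨i, rfl⟩
  positivity

lemma tendsto_slopeInf {v : ℕ → ℕ}
    (hsup : Filter.Tendsto (fun n : ℕ => (v n : ℝ) / n) Filter.atTop Filter.atTop) :
    Filter.Tendsto (slopeInf v) Filter.atTop Filter.atTop := by
  refine Filter.tendsto_atTop.2 fun M => ?_
  obtain ⟨N, hN⟩ := Filter.eventually_atTop.1 (Filter.tendsto_atTop.1 hsup M)
  exact Filter.eventually_atTop.2 ⟨N, fun n hn => le_ciInf fun k => hN _ (by omega)⟩

lemma exists_add_mul_lt {v : ℕ → ℕ}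
    (hsup : Filter.Tendsto (fun n : ℕ => (v n : ℝ) / n) Filter.atTop Filter.atTop)
    (a b : ℝ) (N : ℕ) : ∃ n ≥ N, a + b * n < v n := by
  obtain ⟨n, hn, hnN⟩ := ((Filter.tendsto_atTop.1 hsup (|a| + b + 1)).and
    (Filter.eventually_ge_atTop (max N 1))).exists
  have hn1 : (1 : ℝ) ≤ n := by exact_mod_cast (le_max_right _ _).trans hnN
  refine ⟨n, (le_max_left _ _).trans hnN, ?_⟩
  rw [le_div_iff₀ (by linarith)] at hn
  nlinarith [le_abs_self a, abs_nonneg a]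

lemma one_le_increment {L : ℝ} {v : ℕ → ℕ} (hv_mono : Monotone v)
    (hbgd : ∀ n : ℕ, ((v (n + 2) : ℝ) - v (n + 1)) ≤ L * ((v (n + 1) : ℝ) - v n))
    (hsup : Filter.Tendsto (fun n : ℕ => (v n : ℝ) / n) Filter.atTop Filter.atTop) (n : ℕ) :
    (1 : ℝ) ≤ (v (n + 1) : ℝ) - v n := by
  by_contra! h
  have heq : v (n + 1) = v n := by
    have h1 : (v (n + 1) : ℝ) < (v n + 1 : ℕ) := by push_cast; linarith
    have h2 : v (n + 1) < v n + 1 := by exact_mod_cast h1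
    have : v n ≤ v (n + 1) := hv_mono n.le_succ
    omega
  have hconst : ∀ j, v (n + j + 1) = v (n + j) := by
    intro j
    induction j with
    | zero => exact heq
    | succ j ih =>
      have h1 := hbgd (n + j)
      rw [ih, sub_self, mul_zero] at h1
      have h2 : v (n + j + 2) ≤ v (n + j) := by
        exact_mod_cast sub_nonpos.1 h1
      have := hv_mono (show n + j + 1 ≤ n + j + 2 by omega)
      change v (n + j + 2) = v (n + j + 1)
      omega
  have hval : ∀ j, v (n + j) = v n := fun j => by
    induction j with
    | zero => rfl
    | succ j ih => exact (hconst j).trans ih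
  obtain ⟨k, hk, hlt⟩ := exists_add_mul_lt hsup (v n) 0 n
  obtain ⟨j, rfl⟩ := Nat.exists_eq_add_of_le hk
  rw [hval j] at hlt
  simp at hlt

lemma one_lt_of_increment_le {L : ℝ} (hL : 1 ≤ L) {v : ℕ → ℕ}
    (hbgd : ∀ n : ℕ, ((v (n + 2) : ℝ) - v (n + 1)) ≤ L * ((v (n + 1) : ℝ) - v n))
    (hsup : Filter.Tendsto (fun n : ℕ => (v n : ℝ) / n) Filter.atTop Filter.atTop) : 1 < L := by
  rcases hL.eq_or_lt with rfl | h
  · exfalso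
    have hd : ∀ n, (v (n + 1) : ℝ) - v n ≤ v 1 - v 0 := fun n => by
      induction n with
      | zero => exact le_rfl
      | succ n ih => exact (hbgd n).trans ((one_mul _).trans_le ih)
    have hv : ∀ n : ℕ, (v n : ℝ) ≤ v 0 + (v 1 - v 0) * n := fun n => by
      induction n with
      | zero => simp
      | succ n ih => push_cast; linarith [hd n]
    obtain ⟨n, -, hn⟩ := exists_add_mul_lt hsup (v 0) (v 1 - v 0) 0
    exact (hv n).not_gt hn
  · exact h

theorem stmt1 (L : ℝ) (hL : 1 ≤ L) (v : ℕ → ℕ) (hv_mono : Monotone v)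
    (hbgd : ∀ n : ℕ, ((v (n + 2) : ℝ) - v (n + 1)) ≤ L * ((v (n + 1) : ℝ) - v n))
    (hsup : Filter.Tendsto (fun n : ℕ => (v n : ℝ) / n) Filter.atTop Filter.atTop) :
    ∃ w : ℕ → ℝ,
      SameGrowthType (fun n => (v n : ℝ)) w ∧
      (∀ n : ℕ, 1 / L ≤ w (n + 2) - w (n + 1) ∧
        w (n + 2) - w (n + 1) ≤ L * (w (n + 1) - w n)) ∧
      Filter.Tendsto (fun n => w (n + 1) - w n) Filter.atTop Filter.atTop := by
  have hd1 := one_le_increment hv_mono hbgd hsup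
  set d : ℕ → ℝ := fun n => (v (n + 1) : ℝ) - v n
  set e := raisedIncrements L d (slopeInf v)
  have hde : ∀ n, d n ≤ e n := le_raisedIncrements
  have hstep : ∀ n, (v 0 + ∑ k ∈ Finset.range (n + 1), e k)
      - (v 0 + ∑ k ∈ Finset.range n, e k) = e n := fun n => by
    rw [Finset.sum_range_succ]; ring
  have hsum : ∀ n, (v 0 : ℝ) + ∑ k ∈ Finset.range n, d k = v n := fun n => by
    rw [Finset.sum_range_sub (fun k => (v k : ℝ))]; ring
  have hlow : ∀ n, (v n : ℝ) ≤ v 0 + ∑ k ∈ Finset.range n, e k := fun n => by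
    rw [← hsum n]
    gcongr with k
    exact hde k
  have hup : ∀ n, v 0 + ∑ k ∈ Finset.range n, e k ≤ 2 * (v n : ℝ) := fun n => by
    have h1 : ∑ k ∈ Finset.range n, e k ≤ ∑ k ∈ Finset.range n, (d k + (v n : ℝ) / n) := by
      refine Finset.sum_le_sum fun k hk => ?_
      refine (raisedIncrements_le_add (fun j => zero_le_one.trans (hd1 j))
        (slopeInf_nonneg v) k).trans ?_
      gcongr
      exact slopeInf_le v (Finset.mem_range.1 hk).le
    rw [Finset.sum_add_distrib, Finset.sum_const, Finset.card_range, nsmul_eq_mul] at h1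
    have h2 : (n : ℝ) * ((v n : ℝ) / n) ≤ v n := by
      rcases eq_or_ne (n : ℝ) 0 with h | h
      · simp [h]
      · rw [mul_div_cancel₀ _ h]
    linarith [hsum n]
  refine ⟨fun n => v 0 + ∑ k ∈ Finset.range n, e k, ⟨2, two_pos, fun n => ?_⟩, fun n => ?_, ?_⟩
  · have hv : (v n : ℝ) ≤ v (2 * n + 2) := by exact_mod_cast hv_mono (by omega)
    have h0 : (0 : ℝ) ≤ v (2 * n + 2) := Nat.cast_nonneg _
    have hw := hlow (2 * n + 2)
    push_cast
    constructor
    · linarith [hup n]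
    · linarith
  · beta_reduce
    rw [hstep n, show n + 2 = n + 1 + 1 from rfl, hstep (n + 1)]
    refine ⟨?_, raisedIncrements_succ_le (by linarith) hbgd n⟩
    exact (div_le_one₀ (by linarith)).2 hL |>.trans ((hd1 (n + 1)).trans (hde (n + 1)))
  · simp only [hstep]
    exact tendsto_raisedIncrements (one_lt_of_increment_le hL hbgd hsup) hd1
      (tendsto_slopeInf hsup)
end

section
/- Let κ > 0 be a real number and m ≥ 2 an integer with (m−1)·κ ≤ log 2. Let φ : [0, ∞) → [0, ∞) be a function, integrable on bounded intervals, such that r ↦ φ(r)/(cosh(κ·r))^(m−1) is nonincreasing on [0, ∞). Then for every integer k ≥ 0, ∫_{k+1}^{k+2} φ(r) dr ≤ 2·∫_{k}^{k+1} φ(r) dr. -/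
open Real Set

theorem cosh_add_le_exp_mul_cosh (x : ℝ) {y : ℝ} (hy : 0 ≤ y) :
    Real.cosh (x + y) ≤ Real.exp y * Real.cosh x := by
  have h : Real.exp (-(x + y)) ≤ Real.exp (y + -x) := Real.exp_le_exp.mpr (by linarith)
  rw [Real.exp_add y (-x)] at h
  rw [Real.cosh_eq, Real.cosh_eq, Real.exp_add x y]
  linarith

theorem cosh_pow_add_one_le_two_mul {κ : ℝ} (hκ : 0 ≤ κ) {n : ℕ}
    (hn : n * κ ≤ Real.log 2) (r : ℝ) :
    Real.cosh (κ * (r + 1)) ^ n ≤ 2 * Real.cosh (κ * r) ^ n := by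
  have hexp : Real.exp κ ^ n ≤ 2 := by
    rw [← Real.exp_nat_mul]
    exact (Real.le_log_iff_exp_le two_pos).mp hn
  calc Real.cosh (κ * (r + 1)) ^ n
      ≤ (Real.exp κ * Real.cosh (κ * r)) ^ n := by
        rw [mul_add_one]
        gcongr
        exact cosh_add_le_exp_mul_cosh _ hκ
    _ ≤ 2 * Real.cosh (κ * r) ^ n := by
        rw [mul_pow]
        gcongr

theorem stmt6 (κ : ℝ) (hκ : 0 < κ) (m : ℕ) (hm : 2 ≤ m)
    (hsmall : ((m : ℝ) - 1) * κ ≤ Real.log 2)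
    (φ : ℝ → ℝ) (hφ_nonneg : ∀ r ∈ Ici (0 : ℝ), 0 ≤ φ r)
    (hint : ∀ c d : ℝ, 0 ≤ c → c ≤ d → MeasureTheory.IntegrableOn φ (Icc c d))
    (hmono : AntitoneOn (fun r => φ r / (Real.cosh (κ * r)) ^ (m - 1)) (Ici 0)) :
    ∀ k : ℕ, ∫ r in (k + 1 : ℝ)..(k + 2 : ℝ), φ r ≤ 2 * ∫ r in (k : ℝ)..(k + 1 : ℝ), φ r := by
  have hshift : ∀ r : ℝ, 0 ≤ r → φ (r + 1) ≤ 2 * φ r := by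
    intro r hr
    have hpos : ∀ s : ℝ, 0 < Real.cosh (κ * s) ^ (m - 1) := fun s =>
      pow_pos (Real.cosh_pos _) _
    have hratio : φ (r + 1) / Real.cosh (κ * (r + 1)) ^ (m - 1)
        ≤ φ r / Real.cosh (κ * r) ^ (m - 1) :=
      hmono (mem_Ici.mpr hr) (mem_Ici.mpr (by linarith)) (by linarith)
    have hcosh := cosh_pow_add_one_le_two_mul hκ.le (n := m - 1)
      (by rwa [Nat.cast_sub (by lia), Nat.cast_one]) r
    rw [div_le_iff₀ (hpos _)] at hratio
    calc φ (r + 1)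
        ≤ φ r / Real.cosh (κ * r) ^ (m - 1) * Real.cosh (κ * (r + 1)) ^ (m - 1) := hratio
      _ ≤ φ r / Real.cosh (κ * r) ^ (m - 1) * (2 * Real.cosh (κ * r) ^ (m - 1)) :=
        mul_le_mul_of_nonneg_left hcosh (div_nonneg (hφ_nonneg r hr) (hpos r).le)
      _ = 2 * φ r := by
        have := (hpos r).ne'
        field_simp
  intro k
  have hk : (0 : ℝ) ≤ k := k.cast_nonneg
  have hii : ∀ c d : ℝ, 0 ≤ c → c ≤ d → IntervalIntegrable φ MeasureTheory.volume c d :=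
    fun c d hc hcd => (intervalIntegrable_iff_integrableOn_Icc_of_le hcd).mpr (hint c d hc hcd)
  have htranslate : ∫ r in (k + 1 : ℝ)..(k + 2 : ℝ), φ r
      = ∫ r in (k : ℝ)..(k + 1 : ℝ), φ (r + 1) := by
    rw [intervalIntegral.integral_comp_add_right]
    congr 1
    ring
  rw [htranslate, ← intervalIntegral.integral_const_mul]
  refine intervalIntegral.integral_mono_on (by linarith) ?_
    ((hii _ _ hk (by linarith)).const_mul 2) fun r hr => hshift r (hk.trans hr.1)
  simpa using (hii (k + 1) (k + 1 + 1) (by linarith) (by linarith)).comp_add_right 1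
end

section
/- Let L > 1 be a real number, ℓ ≥ 1 an integer, and let v : ℕ → ℝ be a function with v(k+1) − v(k) > 0 and v(k+2) − v(k+1) ≤ L·(v(k+1) − v(k)) for all k ∈ ℕ. Define z : ℕ → ℝ by z(k·ℓ + s) = v(k) + ((L^(s/ℓ) − 1)/(L − 1))·(v(k+1) − v(k)) for k ∈ ℕ and 0 ≤ s ≤ ℓ (this is consistent at s = ℓ, where z((k+1)·ℓ) = v(k+1)). Then for all n ∈ ℕ, z(n+2) − z(n+1) ≤ L^(1/ℓ)·(z(n+1) − z(n)). -/
open Real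

theorem stmt8 (L : ℝ) (hL : 1 < L) (ℓ : ℕ) (hℓ : 1 ≤ ℓ)
    (v : ℕ → ℝ)
    (hpos : ∀ k : ℕ, 0 < v (k + 1) - v k)
    (hbgd : ∀ k : ℕ, v (k + 2) - v (k + 1) ≤ L * (v (k + 1) - v k))
    (z : ℕ → ℝ)
    (hz : ∀ k s : ℕ, s ≤ ℓ →
      z (k * ℓ + s) = v k + ((L ^ ((s : ℝ) / (ℓ : ℝ)) - 1) / (L - 1)) * (v (k + 1) - v k)) :
    ∀ n : ℕ, z (n + 2) - z (n + 1) ≤ L ^ ((1 : ℝ) / (ℓ : ℝ)) * (z (n + 1) - z n) := by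
  have hL0 : (0 : ℝ) < L - 1 := by linarith
  have hℓ0 : (ℓ : ℝ) ≠ 0 := by positivity
  set r : ℝ := L ^ ((1 : ℝ) / (ℓ : ℝ)) with hr
  have hpow : ∀ s : ℕ, L ^ ((s : ℝ) / (ℓ : ℝ)) = r ^ s := by
    intro s
    rw [hr, ← Real.rpow_natCast, ← Real.rpow_mul (by linarith)]
    congr 1
    ring
  have hrL : r ^ ℓ = L := by
    rw [← hpow ℓ, div_self hℓ0, Real.rpow_one]
  have hr1 : 1 ≤ r := Real.one_le_rpow hL.le (by positivity)
  have hincr : ∀ k s : ℕ, s < ℓ →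
      z (k * ℓ + s + 1) - z (k * ℓ + s) = (r - 1) / (L - 1) * (r ^ s * (v (k + 1) - v k)) := by
    intro k s hs
    rw [add_assoc, hz k (s + 1) hs, hz k s hs.le, hpow, hpow]
    ring
  intro n
  obtain ⟨k, s, hs, rfl⟩ : ∃ k s : ℕ, s < ℓ ∧ n = k * ℓ + s :=
    ⟨n / ℓ, n % ℓ, Nat.mod_lt _ hℓ, (Nat.div_add_mod' n ℓ).symm⟩
  rw [hincr k s hs]
  rcases Nat.lt_or_ge (s + 1) ℓ with h | h
  · have h1 := hincr k (s + 1) h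
    rw [← add_assoc] at h1
    refine (h1.trans ?_).le
    ring
  · have hsl : s + 1 = ℓ := by omega
    have h1 := hincr (k + 1) 0 hℓ
    have e : (k + 1) * ℓ + 0 = k * ℓ + s + 1 := by rw [← hsl]; ring
    rw [e, pow_zero, one_mul] at h1
    calc z (k * ℓ + s + 2) - z (k * ℓ + s + 1)
        = (r - 1) / (L - 1) * (v (k + 2) - v (k + 1)) := h1
      _ ≤ (r - 1) / (L - 1) * (L * (v (k + 1) - v k)) :=
          mul_le_mul_of_nonneg_left (hbgd k) (div_nonneg (by linarith) hL0.le)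
      _ = (r - 1) / (L - 1) * (r ^ (s + 1) * (v (k + 1) - v k)) := by rw [hsl, hrL]
      _ = r * ((r - 1) / (L - 1) * (r ^ s * (v (k + 1) - v k))) := by ring
end

section
/- Let μ < 2 and δ > 0 be real numbers, and let z : ℕ → ℝ be a function satisfying, for all n ∈ ℕ, z(n+1) − z(n) ≥ δ and z(n+2) − z(n+1) ≤ μ·(z(n+1) − z(n)). Then there exists a constant C > 0 such that the integer-valued function w : ℕ → ℤ defined by w(n) = ⌊C·z(n)⌋ satisfies, for all n ∈ ℕ, 2 ≤ w(n+2) − w(n+1) ≤ 2·(w(n+1) − w(n)). -/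
theorem stmt9 (μ δ : ℝ) (hμ : μ < 2) (hδ : 0 < δ) (z : ℕ → ℝ)
    (hlow : ∀ n : ℕ, δ ≤ z (n + 1) - z n)
    (hbgd : ∀ n : ℕ, z (n + 2) - z (n + 1) ≤ μ * (z (n + 1) - z n)) :
    ∃ C : ℝ, 0 < C ∧ ∀ n : ℕ,
      (2 : ℤ) ≤ ⌊C * z (n + 2)⌋ - ⌊C * z (n + 1)⌋ ∧
      ⌊C * z (n + 2)⌋ - ⌊C * z (n + 1)⌋ ≤ 2 * (⌊C * z (n + 1)⌋ - ⌊C * z n⌋) := by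
  have hμ' : 0 < 2 - μ := sub_pos.mpr hμ
  obtain ⟨C, hC, hCδ, hCμ⟩ : ∃ C : ℝ, 0 < C ∧ 3 ≤ C * δ ∧ 3 ≤ (2 - μ) * (C * δ) := by
    refine ⟨(3 + 3 / (2 - μ)) / δ, by positivity, ?_, ?_⟩
    · rw [div_mul_cancel₀ _ hδ.ne']
      linarith [div_pos three_pos hμ']
    · rw [div_mul_cancel₀ _ hδ.ne', mul_add, mul_div_cancel₀ _ hμ'.ne']
      linarith
  refine ⟨C, hC, fun n => ?_⟩
  have hstep : C * δ ≤ C * (z (n + 2) - z (n + 1)) :=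
    mul_le_mul_of_nonneg_left (hlow (n + 1)) hC.le
  have hgap : (2 - μ) * (C * δ) ≤ (2 - μ) * (C * (z (n + 1) - z n)) :=
    mul_le_mul_of_nonneg_left (mul_le_mul_of_nonneg_left (hlow n) hC.le) hμ'.le
  have hratio : C * (z (n + 2) - z (n + 1)) ≤ C * (μ * (z (n + 1) - z n)) :=
    mul_le_mul_of_nonneg_left (hbgd n) hC.le
  have l₀ := Int.floor_le (C * z n)
  have l₁ := Int.floor_le (C * z (n + 1))
  have l₂ := Int.floor_le (C * z (n + 2))
  have u₁ := Int.lt_floor_add_one (C * z (n + 1))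
  have u₂ := Int.lt_floor_add_one (C * z (n + 2))
  constructor
  · have h : (2 : ℝ) < ((⌊C * z (n + 2)⌋ - ⌊C * z (n + 1)⌋ : ℤ) : ℝ) := by
      push_cast
      linarith
    exact_mod_cast h.le
  · have h : ((⌊C * z (n + 2)⌋ - ⌊C * z (n + 1)⌋ : ℤ) : ℝ) ≤
        ((2 * (⌊C * z (n + 1)⌋ - ⌊C * z n⌋) : ℤ) : ℝ) := by
      push_cast
      linarith
    exact_mod_cast h
end
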